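/- For all n and 0 ≤ m < C(n,2) and every j ∈ [n], P(C(σ(n,m+1)) ≥ j) ≤ P(C(σ(n,m)) ≥ j), where C(σ) denotes the number of indecomposable blocks of σ; that is, the number of blocks of a uniformly random permutation with m+1 inversions is stochastically dominated by that of a uniformly random permutation with m inversions. -/

import Mathlib

/-- The number of inversions of `σ`. -/
def invCount {n : ℕ} (σ : Equiv.Perm (Fin n)) : ℕ :=
  (Finset.univ.filter (fun p : Fin n × Fin n => p.1 < p.2 ∧ σ p.2 < σ p.1)).card

/-- `s n m`: the number of permutations of `[n]` with exactly `m` inversions. -/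
def s (n m : ℕ) : ℕ :=
  (Finset.univ.filter (fun σ : Equiv.Perm (Fin n) => invCount σ = m)).card

/-- `σ` is decomposable at position `k`. -/
def DecompAt {n : ℕ} (σ : Equiv.Perm (Fin n)) (k : ℕ) : Prop :=
  ∀ i : Fin n, (i : ℕ) < k → (σ i : ℕ) < k

instance {n : ℕ} (σ : Equiv.Perm (Fin n)) (k : ℕ) : Decidable (DecompAt σ k) :=
  inferInstanceAs (Decidable (∀ i : Fin n, (i : ℕ) < k → (σ i : ℕ) < k))

/-- The number of indecomposable blocks of `σ`: the number of decomposition points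
`k ∈ {1, …, n}` (equivalently, the number of connected components of `G_σ`). -/
def numBlocks {n : ℕ} (σ : Equiv.Perm (Fin n)) : ℕ :=
  ((Finset.Icc 1 n).filter (fun k => DecompAt σ k)).card

section

open Finset

/-- Log-concavity without internal zeros of a sequence indexed by `ℤ`, in four-point form. -/
def FourPointLogConcave (a : ℤ → ℝ) : Prop :=
  ∀ w p q x : ℤ, w ≤ p → w ≤ q → w + x = p + q → a w * a x ≤ a p * a q

theorem FourPointLogConcave.of_adjacent {a : ℤ → ℝ}
    (h : ∀ y z : ℤ, y ≤ z → a y * a (z + 1) ≤ a (y + 1) * a z) : FourPointLogConcave a := by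
  have key : ∀ (d : ℕ) (w x : ℤ), w + d ≤ x - d → a w * a x ≤ a (w + d) * a (x - d) := by
    intro d
    induction d with
    | zero => intro w x _; simp
    | succ d ih =>
      intro w x hwx
      push_cast at hwx ⊢
      have h1 := ih w x (by omega)
      have h2 := h (w + d) (x - d - 1) (by omega)
      rw [show x - d - 1 + 1 = x - (d : ℤ) by ring] at h2
      rw [show w + ((d : ℤ) + 1) = w + d + 1 by ring, show x - ((d : ℤ) + 1) = x - d - 1 by ring]
      exact h1.trans h2
  have ordered : ∀ w p q x : ℤ, w ≤ p → p ≤ q → w + x = p + q → a w * a x ≤ a p * a q := by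
    intro w p q x hwp hpq hsum
    have := key (p - w).toNat w x (by omega)
    rwa [show w + ((p - w).toNat : ℤ) = p by omega,
      show x - ((p - w).toNat : ℤ) = q by omega] at this
  intro w p q x hwp hwq hsum
  rcases le_total p q with hpq | hqp
  · exact ordered w p q x hwp hpq hsum
  · rw [mul_comm (a p)]
    exact ordered w q p x hwq hqp (by omega)

/-- Sums of `a` over a window of length `k` ending at `m`. -/
def windowSum (a : ℤ → ℝ) (k : ℕ) (m : ℤ) : ℝ := ∑ t ∈ range k, a (m - t)

theorem windowSum_succ (a : ℤ → ℝ) (k : ℕ) (m : ℤ) :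
    windowSum a (k + 1) m = windowSum a k m + a (m - k) := by
  simp [windowSum, sum_range_succ]

theorem windowSum_succ_add_one (a : ℤ → ℝ) (k : ℕ) (m : ℤ) :
    windowSum a (k + 1) (m + 1) = windowSum a k m + a (m + 1) := by
  rw [windowSum, sum_range_succ']
  simp [windowSum]

theorem windowSum_mono {a : ℤ → ℝ} (ha : ∀ r, 0 ≤ a r) {k l : ℕ} (hkl : k ≤ l) (m : ℤ) :
    windowSum a k m ≤ windowSum a l m :=
  sum_le_sum_of_subset_of_nonneg (range_mono hkl) fun _ _ _ => ha _

theorem FourPointLogConcave.windowSum {a : ℤ → ℝ} (h : FourPointLogConcave a) (c : ℕ) :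
    FourPointLogConcave (windowSum a (c + 1)) := by
  apply FourPointLogConcave.of_adjacent
  intro y z hyz
  have hz := windowSum_succ_add_one a c z
  have hy := windowSum_succ_add_one a c y
  have hz' := windowSum_succ a c z
  have hy' := windowSum_succ a c y
  have h1 : _root_.windowSum a (c + 1) y * a (z + 1) ≤
      a (y + 1) * _root_.windowSum a (c + 1) z := by
    rw [_root_.windowSum, _root_.windowSum, sum_mul, mul_sum]
    exact sum_le_sum fun t _ => h _ _ _ _ (by omega) (by omega) (by ring)
  have h2 : a (y - c) * _root_.windowSum a (c + 1) z ≤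
      a (z - c) * _root_.windowSum a (c + 1) y := by
    rw [_root_.windowSum, _root_.windowSum, mul_sum, mul_sum]
    refine sum_le_sum fun t ht => ?_
    have := mem_range.1 ht
    exact h _ _ _ _ (by omega) (by omega) (by ring)
  rw [hz, hy, eq_sub_of_add_eq hz'.symm, eq_sub_of_add_eq hy'.symm]
  linarith

theorem FourPointLogConcave.windowSum_mul_le {a : ℤ → ℝ} (h : FourPointLogConcave a) (m : ℤ)
    {t u : ℕ} (htu : t ≤ u) :
    _root_.windowSum a t (m + 1) * _root_.windowSum a u m ≤
      _root_.windowSum a t m * _root_.windowSum a u (m + 1) := by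
  induction u, htu using Nat.le_induction with
  | base => rw [mul_comm]
  | succ u htu ih =>
    rw [windowSum_succ, windowSum_succ, mul_add, mul_add]
    refine add_le_add ih ?_
    rw [_root_.windowSum, _root_.windowSum, sum_mul, sum_mul]
    refine sum_le_sum fun s hs => ?_
    have := mem_range.1 hs
    rw [mul_comm (a (m + 1 - s))]
    exact h _ _ _ _ (by omega) (by omega) (by ring)

/-- Abel summation along a transport that keeps `t` (with mass `Q t - β t`) or moves `t` to
`t + 1` (with mass `β (t + 1)`). -/
theorem sum_transport {P Q β : ℕ → ℝ} (G H : ℕ → ℝ) (h0 : β 0 = 0)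
    (hβ : ∀ t, β (t + 1) = β t + (P t - Q t)) (k : ℕ) :
    ∑ t ∈ range k, (P t * G t - Q t * H t) =
      ∑ t ∈ range k, ((Q t - β t) * (G t - H t) + β (t + 1) * (G t - H (t + 1))) +
        β k * H k := by
  induction k with
  | zero => simp [h0]
  | succ k ih =>
    rw [sum_range_succ, sum_range_succ]
    have := hβ k
    have hP : P k = β (k + 1) - β k + Q k := by linarith
    rw [hP]
    linarith

/-- The inductive step of Efron's monotonicity theorem, for one new coordinate that is uniform
on `{0, …, c}`. -/
theorem windowSum_dominated {a : ℤ → ℝ} (ha : ∀ r, 0 ≤ a r) (hlc : FourPointLogConcave a)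
    {F : ℕ → ℤ → ℝ} (hF0 : ∀ t r, 0 ≤ F t r) (hFa : ∀ t r, F t r ≤ a r)
    (hF : ∀ t r, F t (r + 1) * a r ≤ F t r * a (r + 1))
    (hanti : ∀ t r, F (t + 1) r ≤ F t r) (c : ℕ) (m : ℤ) :
    (∑ t ∈ range (c + 1), F t (m + 1 - t)) * windowSum a (c + 1) m ≤
      (∑ t ∈ range (c + 1), F t (m - t)) * windowSum a (c + 1) (m + 1) := by
  set b := windowSum a (c + 1) with hb
  set β : ℕ → ℝ := fun t => windowSum a t m * b (m + 1) - windowSum a t (m + 1) * b m with hβdef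
  have hβ0 : β 0 = 0 := by simp [hβdef, windowSum]
  have hβc : β (c + 1) = 0 := by simp only [hβdef, hb]; ring
  have hβ : ∀ t : ℕ, β (t + 1) = β t + (a (m - t) * b (m + 1) - a (m + 1 - t) * b m) := by
    intro t
    simp only [hβdef, windowSum_succ]
    ring
  have hβnn : ∀ t, t ≤ c + 1 → 0 ≤ β t := fun t ht => sub_nonneg.2 (hlc.windowSum_mul_le m ht)
  have hαnn : ∀ t : ℕ, t ≤ c → 0 ≤ a (m + 1 - t) * b m - β t := by
    intro t ht
    have e1 : a (m + 1 - t) * b m - β t =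
        windowSum a (t + 1) (m + 1) * b m - windowSum a t m * b (m + 1) := by
      simp only [hβdef, windowSum_succ]
      ring
    have e2 : b (m + 1) ≤ b m + a (m + 1) := by
      rw [hb, windowSum_succ_add_one, windowSum_succ]
      linarith [ha (m - c)]
    have e3 : 0 ≤ windowSum a t m := sum_nonneg fun _ _ => ha _
    have e4 : windowSum a t m ≤ b m := windowSum_mono ha (by omega) m
    rw [e1, windowSum_succ_add_one]
    nlinarith [mul_le_mul_of_nonneg_left e2 e3, mul_le_mul_of_nonneg_left e4 (ha (m + 1))]
  set G : ℕ → ℝ := fun t => F t (m - t) / a (m - t) with hG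
  set H : ℕ → ℝ := fun t => F t (m + 1 - t) / a (m + 1 - t) with hH
  have hdiv : ∀ t r, a r * (F t r / a r) = F t r := by
    intro t r
    rcases eq_or_ne (a r) 0 with h | h
    · have := hFa t r
      have := hF0 t r
      rw [h] at *
      linarith
    · field_simp
  have htr := sum_transport G H hβ0 hβ (c + 1)
  rw [hβc] at htr
  have hnn : 0 ≤ ∑ t ∈ range (c + 1),
      ((a (m + 1 - t) * b m - β t) * (G t - H t) + β (t + 1) * (G t - H (t + 1))) := by
    refine sum_nonneg fun t ht => ?_
    have ht := mem_range.1 ht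
    have hα := hαnn t (by omega)
    have hβ' := hβnn (t + 1) (by omega)
    have hstep : G t - H (t + 1) = (F t (m - t) - F (t + 1) (m - t)) / a (m - t) := by
      simp only [hG, hH]
      rw [show m + 1 - ((t + 1 : ℕ) : ℤ) = m - t by push_cast; ring]
      ring
    refine add_nonneg ?_ (mul_nonneg hβ' ?_)
    · rcases (ha (m - t)).eq_or_lt with h | h
      · have : a (m + 1 - t) * b m - β t = 0 := by
          have := hβ t
          rw [← h] at this
          linarith
        rw [this, zero_mul]
      · refine mul_nonneg hα (sub_nonneg.2 ?_)
        rcases (ha (m + 1 - t)).eq_or_lt with h' | h'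
        · simp only [hH, ← h', div_zero]
          exact div_nonneg (hF0 _ _) (ha _)
        · simp only [hG, hH]
          rw [div_le_div_iff₀ h' h]
          have := hF t (m - t)
          rwa [show m - (t : ℤ) + 1 = m + 1 - t by ring] at this
    · rw [hstep]
      exact div_nonneg (sub_nonneg.2 (hanti _ _)) (ha _)
  rw [← sub_nonneg, sum_mul, sum_mul, ← sum_sub_distrib]
  refine hnn.trans_eq ?_
  rw [show (∑ t ∈ range (c + 1), (F t (m - t) * b (m + 1) - F t (m + 1 - t) * b m)) =
    ∑ t ∈ range (c + 1),
      (a (m - t) * b (m + 1) * G t - a (m + 1 - t) * b m * H t) from sum_congr rfl fun t _ => by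
        rw [← hdiv t (m - t), ← hdiv t (m + 1 - t)]
        ring]
  linarith

/-- The inversion sequences of length `n`: the functions `x` with `x i ≤ i`. -/
def inversionSeqs (n : ℕ) : Finset (Fin n → ℕ) :=
  Fintype.piFinset fun i => range (i + 1)

open Classical in
/-- The number of inversion sequences of length `n` with sum `m` that satisfy `A`. -/
noncomputable def levelCard (n : ℕ) (A : (Fin n → ℕ) → Prop) (m : ℤ) : ℕ :=
  #{x ∈ inversionSeqs n | A x ∧ ∑ i, (x i : ℤ) = m}

theorem levelCard_mono {n : ℕ} {A B : (Fin n → ℕ) → Prop} (h : ∀ x, A x → B x) (m : ℤ) :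
    levelCard n A m ≤ levelCard n B m := by
  classical
  refine card_le_card fun x => ?_
  simp only [mem_filter]
  tauto

theorem levelCard_succ (n : ℕ) (A : (Fin (n + 1) → ℕ) → Prop) (m : ℤ) :
    levelCard (n + 1) A m =
      ∑ t ∈ range (n + 1), levelCard n (fun x => A (Fin.snoc x t)) (m - t) := by
  classical
  rw [levelCard, card_eq_sum_card_fiberwise (f := fun x => x (Fin.last n)) (t := range (n + 1))]
  · refine sum_congr rfl fun t ht => ?_
    refine card_nbij' (fun x => Fin.init x) (fun x => Fin.snoc x t) ?_ ?_ ?_ ?_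
    · intro x hx
      simp only [inversionSeqs, coe_filter, mem_filter, Fintype.mem_piFinset, mem_range,
        Set.mem_ofPred_eq, Fin.sum_univ_castSucc] at hx ⊢
      obtain ⟨⟨h1, h2, h3⟩, rfl⟩ := hx
      refine ⟨fun i => by simpa [Fin.init] using h1 i.castSucc, by simpa using h2, ?_⟩
      simp only [Fin.init]
      linarith
    · intro x hx
      simp only [inversionSeqs, coe_filter, mem_filter, Fintype.mem_piFinset, mem_range,
        Set.mem_ofPred_eq, Fin.sum_univ_castSucc, Fin.snoc_castSucc, Fin.snoc_last] at hx ht ⊢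
      obtain ⟨h1, h2, h3⟩ := hx
      refine ⟨⟨fun i => ?_, h2, by linarith⟩, trivial⟩
      induction i using Fin.lastCases with
      | last => simpa using ht
      | cast i => simpa using h1 i
    · intro x hx
      simp only [coe_filter, mem_filter, Set.mem_ofPred_eq] at hx
      rw [← hx.2]
      exact Fin.snoc_init_self x
    · intro x _
      exact Fin.init_snoc _ _
  · intro x hx
    simp only [inversionSeqs, coe_filter, Fintype.mem_piFinset, Set.mem_ofPred_eq] at hx
    simpa using hx.1 (Fin.last n)

theorem levelCard_true_succ (n : ℕ) (m : ℤ) :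
    (levelCard (n + 1) (fun _ => True) m : ℝ) =
      windowSum (fun r => (levelCard n (fun _ => True) r : ℝ)) (n + 1) m := by
  rw [levelCard_succ, windowSum]
  push_cast
  rfl

theorem levelCard_fourPointLogConcave (n : ℕ) :
    FourPointLogConcave fun r => (levelCard n (fun _ => True) r : ℝ) := by
  induction n with
  | zero =>
    have h : ∀ r : ℤ, (levelCard 0 (fun _ => True) r : ℝ) = if r = 0 then 1 else 0 := by
      intro r
      rcases eq_or_ne r 0 with rfl | hr
      · simp [levelCard, inversionSeqs]
      · simp [levelCard, hr, hr.symm]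
    intro w p q x hp hq hsum
    simp only [h]
    split_ifs <;> first | omega | norm_num
  | succ n ih =>
    simp only [levelCard_true_succ]
    exact ih.windowSum n

/-- Antitone events lose density from each level of the inversion sequences to the next. -/
theorem levelCard_dominated {n : ℕ} {A : (Fin n → ℕ) → Prop}
    (hA : ∀ x y, x ≤ y → A y → A x) (m : ℤ) :
    (levelCard n A (m + 1) : ℝ) * levelCard n (fun _ => True) m ≤
      levelCard n A m * levelCard n (fun _ => True) (m + 1) := by
  induction n generalizing m with
  | zero =>
    have h : ∀ (B : (Fin 0 → ℕ) → Prop) (r : ℤ), r ≠ 0 → levelCard 0 B r = 0 := by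
      intro B r hr
      simp [levelCard, hr.symm]
    rcases eq_or_ne m 0 with rfl | hm
    · rw [h A (0 + 1) (by norm_num)]
      simp only [Nat.cast_zero, zero_mul]
      positivity
    · rw [h _ m hm]
      simp only [Nat.cast_zero, mul_zero]
      positivity
  | succ n ih =>
    simp only [levelCard_true_succ]
    rw [levelCard_succ n A, levelCard_succ n A]
    push_cast
    refine windowSum_dominated (F := fun t r => (levelCard n (fun x => A (Fin.snoc x t)) r : ℝ))
      (fun _ => Nat.cast_nonneg _) (levelCard_fourPointLogConcave n)
      (fun _ _ => Nat.cast_nonneg _) (fun _ _ => Nat.cast_le.2 (levelCard_mono (by simp) _))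
      (fun t r => ih (fun x y hxy => hA _ _ ?_) r)
      (fun t r => Nat.cast_le.2 (levelCard_mono (fun x => hA _ _ ?_) _)) n m
    · intro i
      induction i using Fin.lastCases with
      | last => simp
      | cast i => simpa using hxy i
    · intro i
      induction i using Fin.lastCases with
      | last => simp
      | cast i => simp

/-- The number of inversions of `σ` whose right end is the position `i`. -/
def inversionSeq {n : ℕ} (σ : Equiv.Perm (Fin n)) (i : Fin n) : ℕ :=
  #{j | j < i ∧ σ i < σ j}

theorem sum_inversionSeq {n : ℕ} (σ : Equiv.Perm (Fin n)) :
    ∑ i, inversionSeq σ i = invCount σ := by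
  rw [invCount, card_eq_sum_card_fiberwise (f := Prod.snd) (t := univ) (by simp)]
  refine sum_congr rfl fun i _ => ?_
  refine card_nbij' (fun j => (j, i)) Prod.fst ?_ ?_ ?_ ?_
  · intro j; simp
  · rintro ⟨j, k⟩ hjk
    simp only [coe_filter, mem_filter, mem_univ, true_and, Set.mem_ofPred_eq] at hjk ⊢
    rw [← hjk.2]
    exact hjk.1
  · intro j; simp
  · rintro ⟨j, k⟩ hjk
    simp only [coe_filter, mem_filter, Set.mem_ofPred_eq] at hjk
    rw [← hjk.2]

theorem inversionSeq_add_card {n : ℕ} (σ : Equiv.Perm (Fin n)) (i : Fin n) :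
    inversionSeq σ i + #{j | j < i ∧ σ j < σ i} = i := by
  rw [inversionSeq, ← card_union_of_disjoint]
  · rw [← filter_or]
    conv_rhs => rw [← Fin.card_Iio i]
    congr 1
    ext j
    simp only [mem_filter, mem_univ, true_and, mem_Iio]
    have : j ≠ i → σ j ≠ σ i := fun h => σ.injective.ne h
    constructor
    · rintro (h | h) <;> exact h.1
    · intro h
      rcases lt_or_gt_of_ne (this h.ne) with h' | h'
      · exact Or.inr ⟨h, h'⟩
      · exact Or.inl ⟨h, h'⟩
  · rw [disjoint_filter]
    intro j _ h1 h2
    exact lt_asymm h1.2 h2.2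

theorem inversionSeq_mem {n : ℕ} (σ : Equiv.Perm (Fin n)) : inversionSeq σ ∈ inversionSeqs n := by
  simp only [inversionSeqs, Fintype.mem_piFinset, mem_range]
  intro i
  have := inversionSeq_add_card σ i
  omega

theorem inversionSeq_injective (n : ℕ) :
    Function.Injective (inversionSeq : Equiv.Perm (Fin n) → Fin n → ℕ) := by
  have hlt : ∀ (σ τ : Equiv.Perm (Fin n)) (i : Fin n), (∀ j, i < j → σ j = τ j) →
      σ i < τ i → inversionSeq τ i < inversionSeq σ i := by
    intro σ τ i hj hi
    have hcard : ∀ ρ : Equiv.Perm (Fin n), inversionSeq ρ i =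
        #{v | ρ.symm v < i ∧ ρ i < v} := by
      intro ρ
      exact card_nbij' ρ ρ.symm (by intro j; simp) (by intro j; simp) (by intro j; simp)
        (by intro j; simp)
    have hsymm : ∀ v, i < σ.symm v ↔ i < τ.symm v := by
      intro v
      constructor
      · intro h
        have := hj _ h
        rw [Equiv.apply_symm_apply] at this
        rwa [this, Equiv.symm_apply_apply]
      · intro h
        have := hj _ h
        rw [Equiv.apply_symm_apply] at this
        rwa [← this, Equiv.symm_apply_apply]
    have hmem : ∀ v, σ i < v → σ.symm v ≤ i → σ.symm v < i := by
      intro v hv h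
      refine lt_of_le_of_ne h ?_
      rintro rfl
      simp at hv
    rw [hcard, hcard]
    refine card_lt_card (ssubset_iff_of_subset ?_ |>.2 ⟨τ i, ?_, ?_⟩)
    · intro v
      simp only [mem_filter, mem_univ, true_and]
      rintro ⟨h1, h2⟩
      have h3 := hi.trans h2
      exact ⟨hmem v h3 (not_lt.1 fun h => lt_asymm h1 ((hsymm v).1 h)), h3⟩
    · simp only [mem_filter, mem_univ, true_and]
      refine ⟨hmem _ hi (not_lt.1 fun h => ?_), hi⟩
      have := (hsymm _).1 h
      simp at this
    · simp
  intro σ τ h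
  ext i
  congr 1
  induction i using WellFoundedGT.induction with
  | ind i ih =>
    rcases lt_trichotomy (σ i) (τ i) with h' | h' | h'
    · exact absurd (congrFun h i) (hlt σ τ i ih h').ne'
    · exact h'
    · exact absurd (congrFun h i) (hlt τ σ i (fun j hj => (ih j hj).symm) h').ne

theorem image_inversionSeq (n : ℕ) :
    (univ : Finset (Equiv.Perm (Fin n))).image inversionSeq = inversionSeqs n := by
  refine eq_of_subset_of_card_le ?_ ?_
  · intro x hx
    obtain ⟨σ, -, rfl⟩ := mem_image.1 hx
    exact inversionSeq_mem σ
  · rw [card_image_of_injective _ (inversionSeq_injective n), card_univ, Fintype.card_perm,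
      Fintype.card_fin, inversionSeqs, Fintype.card_piFinset]
    simp only [card_range]
    rw [Fin.prod_univ_eq_prod_range (fun i => i + 1), prod_range_add_one_eq_factorial]

theorem decompAt_iff {n : ℕ} (σ : Equiv.Perm (Fin n)) {k : ℕ} (hk : k ≤ n) :
    DecompAt σ k ↔ ∀ i : Fin n, k ≤ i → inversionSeq σ i + k ≤ i := by
  have hcard : #{i : Fin n | (i : ℕ) < k} = k := by
    rw [Fin.card_filter_val_lt, min_eq_right hk]
  have hmaps : DecompAt σ k → ∀ i : Fin n, k ≤ i → k ≤ (σ i : ℕ) := by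
    intro h i hi
    by_contra! hlt
    have himg : image σ {i : Fin n | (i : ℕ) < k} = ({i : Fin n | (i : ℕ) < k} : Finset (Fin n)) := by
      refine eq_of_subset_of_card_le ?_ (card_image_of_injective _ σ.injective).ge
      intro v hv
      obtain ⟨j, hj, rfl⟩ := mem_image.1 hv
      simpa using h j (by simpa using hj)
    have : σ i ∈ image σ {i : Fin n | (i : ℕ) < k} := by
      rw [himg]; simpa using hlt
    obtain ⟨j, hj, hji⟩ := mem_image.1 this
    rw [σ.injective hji] at hj
    simp at hj
    omega
  constructor
  · intro h i hi
    have hsub : #{j : Fin n | (j : ℕ) < k} ≤ #{j | j < i ∧ σ j < σ i} := by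
      refine card_le_card fun j => ?_
      simp only [mem_filter, mem_univ, true_and, Fin.lt_def]
      intro hj
      have := h j hj
      have := hmaps h i hi
      omega
    have := inversionSeq_add_card σ i
    omega
  · intro h
    have hge : ∀ i : Fin n, k ≤ i → k ≤ (σ i : ℕ) := by
      intro i hi
      have h1 := h i hi
      have h2 := inversionSeq_add_card σ i
      have h3 : #{j | j < i ∧ σ j < σ i} ≤ #(Iio (σ i)) := by
        rw [← card_image_of_injective _ σ.injective]
        refine card_le_card fun v => ?_
        simp only [mem_image, mem_filter, mem_univ, true_and, mem_Iio]
        rintro ⟨j, hj, rfl⟩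
        exact hj.2
      rw [Fin.card_Iio] at h3
      omega
    have himg : image σ {i : Fin n | k ≤ (i : ℕ)} = ({i : Fin n | k ≤ (i : ℕ)} : Finset (Fin n)) := by
      refine eq_of_subset_of_card_le ?_ (card_image_of_injective _ σ.injective).ge
      intro v hv
      obtain ⟨j, hj, rfl⟩ := mem_image.1 hv
      simpa using hge j (by simpa using hj)
    intro i hi
    by_contra! hlt
    have : σ i ∈ image σ {i : Fin n | k ≤ (i : ℕ)} := by
      rw [himg]; simpa using hlt
    obtain ⟨j, hj, hji⟩ := mem_image.1 this
    rw [σ.injective hji] at hj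
    simp at hj
    omega

open Classical in
/-- The number of decomposition points of the permutation with inversion sequence `x`. -/
noncomputable def seqBlocks {n : ℕ} (x : Fin n → ℕ) : ℕ :=
  #{k ∈ Icc 1 n | ∀ i : Fin n, k ≤ (i : ℕ) → x i + k ≤ i}

theorem seqBlocks_inversionSeq {n : ℕ} (σ : Equiv.Perm (Fin n)) :
    seqBlocks (inversionSeq σ) = numBlocks σ := by
  classical
  refine congrArg card (filter_congr fun k hk => ?_)
  exact (decompAt_iff σ (mem_Icc.1 hk).2).symm

theorem seqBlocks_antitone {n : ℕ} : Antitone (seqBlocks : (Fin n → ℕ) → ℕ) := by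
  classical
  intro x y hxy
  refine card_le_card fun k => ?_
  simp only [mem_filter]
  exact fun ⟨hk, h⟩ => ⟨hk, fun i hi => (Nat.add_le_add_right (hxy i) k).trans (h i hi)⟩

theorem card_perm_eq_levelCard {n : ℕ} (A : (Fin n → ℕ) → Prop) (m : ℕ) :
    Nat.card {σ : Equiv.Perm (Fin n) // invCount σ = m ∧ A (inversionSeq σ)} =
      levelCard n A m := by
  classical
  rw [Nat.card_eq_fintype_card, Fintype.card_subtype, levelCard, ← image_inversionSeq,
    filter_image, card_image_of_injective _ (inversionSeq_injective n)]
  congr 1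
  ext σ
  simp only [mem_filter, mem_univ, true_and, ← sum_inversionSeq]
  rw [and_comm]
  norm_cast

end

/-- Stochastic dominance: for every `j ∈ [n]`,
`P(C(σ(n,m+1)) ≥ j) ≤ P(C(σ(n,m)) ≥ j)`, where `C` is the number of indecomposable
blocks.  Cross-multiplying by `s(n,m)·s(n,m+1)`, this reads as below. -/
theorem numBlocks_stochastically_dominated (n m : ℕ) (hm : m < n.choose 2)
    (j : ℕ) (hj1 : 1 ≤ j) (hjn : j ≤ n) :
    Nat.card {σ : Equiv.Perm (Fin n) // invCount σ = m + 1 ∧ j ≤ numBlocks σ} * s n m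
      ≤ Nat.card {σ : Equiv.Perm (Fin n) // invCount σ = m ∧ j ≤ numBlocks σ} * s n (m + 1) := by
  have hs : ∀ r : ℕ, s n r = levelCard n (fun _ => True) r := by
    intro r
    rw [← card_perm_eq_levelCard, Nat.card_eq_fintype_card, Fintype.card_subtype, s]
    simp
  have hblocks : ∀ r : ℕ, Nat.card {σ : Equiv.Perm (Fin n) // invCount σ = r ∧ j ≤ numBlocks σ} =
      levelCard n (fun x => j ≤ seqBlocks x) r := by
    intro r
    simp only [← card_perm_eq_levelCard, seqBlocks_inversionSeq]
  rw [hs, hs, hblocks, hblocks]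
  have := levelCard_dominated (A := fun x : Fin n → ℕ => j ≤ seqBlocks x)
    (fun x y hxy hy => hy.trans (seqBlocks_antitone hxy)) m
  exact_mod_cast this
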